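/- Let A=(A;R1,R2,R3,R4) be an instance, G its D-graph, and G'' the semi-compactor of G. If G'' admits a compaction to the reflexive 4-cycle H, then G'' retracts to H (on the distinguished vertices h0,h1,h2,h3). -/

import Mathlib

namespace Paper

/-- The relation `S1 = {(0,3),(1,1),(3,1),(3,3)}`. -/
def S1 : Set (ℕ × ℕ) := {(0, 3), (1, 1), (3, 1), (3, 3)}

/-- The relation `S2 = {(1,0),(1,1),(3,1),(3,3)}`. -/
def S2 : Set (ℕ × ℕ) := {(1, 0), (1, 1), (3, 1), (3, 3)}

/-- The relation `S3 = {(1,3),(3,1),(3,3)}`. -/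
def S3 : Set (ℕ × ℕ) := {(1, 3), (3, 1), (3, 3)}

/-- The relation `S4 = {(1,1),(1,3),(3,1)}`. -/
def S4 : Set (ℕ × ℕ) := {(1, 1), (1, 3), (3, 1)}

/-- The domain `{0,1,3}` of the structure `D`. -/
def Dom : Set ℕ := {0, 1, 3}

/-- An instance: four binary relations on a set `α` such that every element
occurs in at least one pair of `R1 ∪ R2 ∪ R3 ∪ R4`. -/
structure Inst (α : Type) : Type where
  R1 : Set (α × α)
  R2 : Set (α × α)
  R3 : Set (α × α)
  R4 : Set (α × α)
  cover : ∀ a : α, (∃ b, (a, b) ∈ R1 ∪ R2 ∪ R3 ∪ R4) ∨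
    (∃ b, (b, a) ∈ R1 ∪ R2 ∪ R3 ∪ R4)

variable {α : Type}

/-- The set `L` of elements occurring as a first coordinate. -/
def Inst.L (I : Inst α) : Set α :=
  {p | ∃ q, (p, q) ∈ I.R1 ∪ I.R2 ∪ I.R3 ∪ I.R4}

/-- The set `R` of elements occurring as a second coordinate. -/
def Inst.Rs (I : Inst α) : Set α :=
  {q | ∃ p, (p, q) ∈ I.R1 ∪ I.R2 ∪ I.R3 ∪ I.R4}

/-- The non-`H` vertices of the D-graph: the elements of `A`, the vertices
`a_p, b_p` for `p ∈ L` and the vertices `c_q, d_q` for `q ∈ R`. -/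
abbrev Core (I : Inst α) : Type := α ⊕ ↥I.L ⊕ ↥I.L ⊕ ↥I.Rs ⊕ ↥I.Rs

/-- The vertex set of the D-graph: `h0,h1,h2,h3` (indexed by `ZMod 4`)
together with the non-`H` vertices. -/
abbrev DVert (I : Inst α) : Type := ZMod 4 ⊕ Core I

def ce (I : Inst α) (a : α) : Core I := Sum.inl a
def ca (I : Inst α) (p : ↥I.L) : Core I := Sum.inr (Sum.inl p)
def cb (I : Inst α) (p : ↥I.L) : Core I := Sum.inr (Sum.inr (Sum.inl p))
def cc (I : Inst α) (q : ↥I.Rs) : Core I := Sum.inr (Sum.inr (Sum.inr (Sum.inl q)))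
def cd (I : Inst α) (q : ↥I.Rs) : Core I := Sum.inr (Sum.inr (Sum.inr (Sum.inr q)))

/-- The vertex `h_i`. -/
def hv (I : Inst α) (i : ZMod 4) : DVert I := Sum.inl i
/-- The vertex corresponding to an element `a ∈ A`. -/
def ev (I : Inst α) (a : α) : DVert I := Sum.inr (ce I a)
/-- The vertex `a_p` for `p ∈ L`. -/
def av (I : Inst α) (p : ↥I.L) : DVert I := Sum.inr (ca I p)
/-- The vertex `b_p` for `p ∈ L`. -/
def bv (I : Inst α) (p : ↥I.L) : DVert I := Sum.inr (cb I p)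
/-- The vertex `c_q` for `q ∈ R`. -/
def cv (I : Inst α) (q : ↥I.Rs) : DVert I := Sum.inr (cc I q)
/-- The vertex `d_q` for `q ∈ R`. -/
def dv (I : Inst α) (q : ↥I.Rs) : DVert I := Sum.inr (cd I q)

/-- The (directed) list of edges of the D-graph. -/
def dBase (I : Inst α) : DVert I → DVert I → Prop := fun u v =>
  (∃ i : ZMod 4, u = hv I i ∧ v = hv I (i + 1)) ∨
  (∃ p : ↥I.L,
    (u = av I p ∧ v = ev I ↑p) ∨ (u = bv I p ∧ v = ev I ↑p) ∨
    (u = av I p ∧ v = bv I p) ∨ (u = av I p ∧ v = hv I 0) ∨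
    (u = av I p ∧ v = hv I 3) ∨ (u = bv I p ∧ v = hv I 1) ∨
    (u = bv I p ∧ v = hv I 2)) ∨
  (∃ q : ↥I.Rs,
    (u = cv I q ∧ v = ev I ↑q) ∨ (u = dv I q ∧ v = ev I ↑q) ∨
    (u = cv I q ∧ v = dv I q) ∨ (u = cv I q ∧ v = hv I 2) ∨
    (u = cv I q ∧ v = hv I 3) ∨ (u = dv I q ∧ v = hv I 0) ∨
    (u = dv I q ∧ v = hv I 1)) ∨
  (∃ a : α, u = hv I 0 ∧ v = ev I a) ∨
  (∃ p q, (p, q) ∈ I.R1 ∧ ∃ hq : q ∈ I.Rs,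
    ((u = cv I ⟨q, hq⟩ ∧ v = ev I p) ∨ (u = ev I q ∧ v = hv I 2))) ∨
  (∃ p q, (p, q) ∈ I.R2 ∧ ∃ hp : p ∈ I.L,
    ((u = ev I p ∧ v = hv I 2) ∨ (u = bv I ⟨p, hp⟩ ∧ v = ev I q))) ∨
  (∃ p q, (p, q) ∈ I.R3 ∧ ∃ hp : p ∈ I.L, ∃ hq : q ∈ I.Rs,
    ((u = ev I p ∧ v = hv I 2) ∨ (u = ev I q ∧ v = hv I 2) ∨
     (u = av I ⟨p, hp⟩ ∧ v = cv I ⟨q, hq⟩))) ∨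
  (∃ p q, (p, q) ∈ I.R4 ∧ ∃ hp : p ∈ I.L, ∃ hq : q ∈ I.Rs,
    ((u = ev I p ∧ v = hv I 2) ∨ (u = ev I q ∧ v = hv I 2) ∨
     (u = bv I ⟨p, hp⟩ ∧ v = dv I ⟨q, hq⟩))) ∨
  (∃ p p' : ↥I.L, p ≠ p' ∧
    ((u = av I p ∧ v = av I p') ∨ (u = bv I p ∧ v = bv I p'))) ∨
  (∃ q q' : ↥I.Rs, q ≠ q' ∧
    ((u = cv I q ∧ v = cv I q') ∨ (u = dv I q ∧ v = dv I q')))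

/-- The D-graph of an instance: the simple graph whose edges are exactly
the (symmetrised) pairs listed in `dBase`. -/
def DGraph (I : Inst α) : SimpleGraph (DVert I) := SimpleGraph.fromRel (dBase I)

/-- Adjacency in the reflexive 4-cycle `H` between *distinct* vertices
(`h_i h_{i+1}` cycle edges), vertices indexed by `ZMod 4`. -/
def C4adj (x y : ZMod 4) : Prop := y = x + 1 ∨ x = y + 1

/-- A homomorphism from a simple graph `G` to the reflexive 4-cycle `H`:
every edge is mapped to a self-loop or to a cycle edge of `H`. -/
def IsHomC4 {V : Type} (G : SimpleGraph V) (f : V → ZMod 4) : Prop :=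
  ∀ u v : V, G.Adj u v → f u = f v ∨ C4adj (f u) (f v)

/-- A retraction from the D-graph to `H`: a homomorphism fixing `h0,…,h3`. -/
def DRetr (I : Inst α) (g : DVert I → ZMod 4) : Prop :=
  IsHomC4 (DGraph I) g ∧ ∀ i : ZMod 4, g (hv I i) = i

/-- A homomorphism from the instance `I` to the structure `D`. -/
def InstHom (I : Inst α) (f : α → ℕ) : Prop :=
  (∀ a : α, f a ∈ Dom) ∧
  (∀ p q, (p, q) ∈ I.R1 → (f p, f q) ∈ S1) ∧
  (∀ p q, (p, q) ∈ I.R2 → (f p, f q) ∈ S2) ∧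
  (∀ p q, (p, q) ∈ I.R3 → (f p, f q) ∈ S3) ∧
  (∀ p q, (p, q) ∈ I.R4 → (f p, f q) ∈ S4)

/-- The ordered pairs `(v,v')` of non-`H` vertices of the D-graph for which an
`x`-vertex `x_{v,v'}` is created in the semi-compactor. -/
def XPairs (I : Inst α) : Set (Core I × Core I) :=
  {pr : Core I × Core I |
    (∃ p : ↥I.L, pr = (ca I p, ce I ↑p) ∨ pr = (ce I ↑p, cb I p) ∨
      pr = (ca I p, cb I p)) ∨
    (∃ q : ↥I.Rs, pr = (ce I ↑q, cc I q) ∨ pr = (ce I ↑q, cd I q) ∨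
      pr = (cd I q, cc I q)) ∨
    (∃ p q, (p, q) ∈ I.R1 ∧ ∃ hq : q ∈ I.Rs, pr = (ce I p, cc I ⟨q, hq⟩)) ∨
    (∃ p q, (p, q) ∈ I.R2 ∧ ∃ hp : p ∈ I.L, pr = (ce I q, cb I ⟨p, hp⟩)) ∨
    (∃ p q, (p, q) ∈ I.R3 ∧ ∃ hp : p ∈ I.L, ∃ hq : q ∈ I.Rs,
      pr = (ca I ⟨p, hp⟩, cc I ⟨q, hq⟩)) ∨
    (∃ p q, (p, q) ∈ I.R4 ∧ ∃ hp : p ∈ I.L, ∃ hq : q ∈ I.Rs,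
      pr = (cd I ⟨q, hq⟩, cb I ⟨p, hp⟩))}

/-- The vertex set of the semi-compactor `G''`: the vertices of the D-graph,
vertices `u_v, w_v, y_v` for every non-`H` vertex `v`, and the `x`-vertices. -/
abbrev SVert (I : Inst α) : Type := DVert I ⊕ Core I ⊕ Core I ⊕ Core I ⊕ ↥(XPairs I)

/-- A vertex of the D-graph viewed inside the semi-compactor. -/
def sg (I : Inst α) (v : DVert I) : SVert I := Sum.inl v
/-- The vertex `u_v`. -/
def su (I : Inst α) (v : Core I) : SVert I := Sum.inr (Sum.inl v)
/-- The vertex `w_v`. -/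
def sw (I : Inst α) (v : Core I) : SVert I := Sum.inr (Sum.inr (Sum.inl v))
/-- The vertex `y_v`. -/
def sy (I : Inst α) (v : Core I) : SVert I := Sum.inr (Sum.inr (Sum.inr (Sum.inl v)))
/-- The vertex `x_{v,v'}`. -/
def sx (I : Inst α) (e : ↥(XPairs I)) : SVert I := Sum.inr (Sum.inr (Sum.inr (Sum.inr e)))

/-- The (directed) list of edges of the semi-compactor `G''`. -/
def sBase (I : Inst α) : SVert I → SVert I → Prop := fun s t =>
  (∃ u v : DVert I, dBase I u v ∧ s = sg I u ∧ t = sg I v) ∨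
  (∃ v : Core I,
    (s = su I v ∧ t = sg I (hv I 0)) ∨ (s = su I v ∧ t = sg I (hv I 1)) ∨
    (s = sy I v ∧ t = sg I (hv I 0)) ∨ (s = sy I v ∧ t = sg I (hv I 2)) ∨
    (s = sw I v ∧ t = sg I (hv I 2)) ∨ (s = sw I v ∧ t = sg I (hv I 3)) ∨
    (s = su I v ∧ t = sg I (Sum.inr v)) ∨ (s = su I v ∧ t = sw I v) ∨
    (s = su I v ∧ t = sy I v) ∨ (s = sg I (Sum.inr v) ∧ t = sw I v) ∨
    (s = sw I v ∧ t = sy I v)) ∨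
  (∃ v v' : Core I, v ≠ v' ∧
    ((s = su I v ∧ t = su I v') ∨ (s = sw I v ∧ t = sw I v'))) ∨
  (∃ e : ↥(XPairs I),
    (s = sx I e ∧ t = sg I (Sum.inr e.val.1)) ∨
    (s = sx I e ∧ t = sg I (Sum.inr e.val.2)) ∨
    (s = sx I e ∧ t = su I e.val.1) ∨
    (s = sx I e ∧ t = sw I e.val.2) ∨
    (s = sx I e ∧ t = sg I (hv I 0)) ∨ (s = sx I e ∧ t = sg I (hv I 2)))

/-- The semi-compactor `G''` of the D-graph of `I`. -/
def SGraph (I : Inst α) : SimpleGraph (SVert I) := SimpleGraph.fromRel (sBase I)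

/-- A retraction from the semi-compactor to `H`: a homomorphism fixing `h0,…,h3`. -/
def SRetr (I : Inst α) (g : SVert I → ZMod 4) : Prop :=
  IsHomC4 (SGraph I) g ∧ ∀ i : ZMod 4, g (sg I (hv I i)) = i

/-- A compaction from a simple graph `G` to the reflexive 4-cycle `H`:
a homomorphism such that every cycle edge of `H` is the image of an edge. -/
def IsCompactionC4 {V : Type} (G : SimpleGraph V) (f : V → ZMod 4) : Prop :=
  IsHomC4 G f ∧ ∀ x y : ZMod 4, C4adj x y → ∃ u v : V, G.Adj u v ∧ f u = x ∧ f v = y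

/-- Equality or adjacency in the reflexive 4-cycle `H`. -/
def Near (x y : ZMod 4) : Prop := x = y ∨ C4adj x y

instance : DecidableRel C4adj := fun x y => by
  unfold C4adj; infer_instance

instance : DecidableRel Near := fun x y => by
  unfold Near; infer_instance

theorem Near.refl (x : ZMod 4) : Near x x := Or.inl rfl

theorem Near.symm {x y : ZMod 4} (h : Near x y) : Near y x := by
  revert x y; decide

theorem IsHomC4.near_of_adj {V : Type} {G : SimpleGraph V} {f : V → ZMod 4}
    (hf : IsHomC4 G f) {s t : V} (h : G.Adj s t) : Near (f s) (f t) := hf s t h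

section

variable {I : Inst α} {f : SVert I → ZMod 4}

theorem near_of_sBase (hf : IsHomC4 (SGraph I) f) {s t : SVert I} (h : sBase I s t) :
    Near (f s) (f t) := by
  by_cases hst : s = t
  · subst hst; exact Near.refl _
  · exact hf.near_of_adj ((SimpleGraph.fromRel_adj _ _ _).2 ⟨hst, Or.inl h⟩)

theorem near_of_dBase (hf : IsHomC4 (SGraph I) f) {u v : DVert I} (h : dBase I u v) :
    Near (f (sg I u)) (f (sg I v)) :=
  near_of_sBase hf (Or.inl ⟨u, v, h, rfl, rfl⟩)

theorem near_cycle (hf : IsHomC4 (SGraph I) f) (i : ZMod 4) :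
    Near (f (sg I (hv I i))) (f (sg I (hv I (i + 1)))) :=
  near_of_dBase hf (Or.inl ⟨i, rfl, rfl⟩)

theorem near_av (hf : IsHomC4 (SGraph I) f) (p : ↥I.L) :
    Near (f (sg I (av I p))) (f (sg I (hv I 0))) :=
  near_of_dBase hf (Or.inr (Or.inl ⟨p, by tauto⟩))

theorem near_bv (hf : IsHomC4 (SGraph I) f) (p : ↥I.L) :
    Near (f (sg I (bv I p))) (f (sg I (hv I 2))) :=
  near_of_dBase hf (Or.inr (Or.inl ⟨p, by tauto⟩))

theorem near_cv (hf : IsHomC4 (SGraph I) f) (q : ↥I.Rs) :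
    Near (f (sg I (cv I q))) (f (sg I (hv I 2))) :=
  near_of_dBase hf (Or.inr (Or.inr (Or.inl ⟨q, by tauto⟩)))

theorem near_dv (hf : IsHomC4 (SGraph I) f) (q : ↥I.Rs) :
    Near (f (sg I (dv I q))) (f (sg I (hv I 0))) :=
  near_of_dBase hf (Or.inr (Or.inr (Or.inl ⟨q, by tauto⟩)))

theorem near_ev (hf : IsHomC4 (SGraph I) f) (a : α) :
    Near (f (sg I (ev I a))) (f (sg I (hv I 0))) :=
  (near_of_dBase hf (Or.inr (Or.inr (Or.inr (Or.inl ⟨a, rfl, rfl⟩))))).symm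

theorem near_hv (hf : IsHomC4 (SGraph I) f) :
    Near (f (sg I (hv I 1))) (f (sg I (hv I 0))) ∧
    Near (f (sg I (hv I 3))) (f (sg I (hv I 0))) ∧
    Near (f (sg I (hv I 1))) (f (sg I (hv I 2))) ∧
    Near (f (sg I (hv I 3))) (f (sg I (hv I 2))) :=
  ⟨(near_cycle hf 0).symm, near_cycle hf 3, near_cycle hf 1, (near_cycle hf 2).symm⟩

/-- The edges at `u_v`, `w_v`, `y_v`, apart from those between different gadgets. -/
theorem near_gadget (hf : IsHomC4 (SGraph I) f) (v : Core I) :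
    Near (f (su I v)) (f (sg I (hv I 0))) ∧ Near (f (su I v)) (f (sg I (hv I 1))) ∧
    Near (f (sy I v)) (f (sg I (hv I 0))) ∧ Near (f (sy I v)) (f (sg I (hv I 2))) ∧
    Near (f (sw I v)) (f (sg I (hv I 2))) ∧ Near (f (sw I v)) (f (sg I (hv I 3))) ∧
    Near (f (su I v)) (f (sg I (Sum.inr v))) ∧ Near (f (su I v)) (f (sw I v)) ∧
    Near (f (su I v)) (f (sy I v)) ∧ Near (f (sg I (Sum.inr v))) (f (sw I v)) ∧
    Near (f (sw I v)) (f (sy I v)) := by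
  refine ⟨?_, ?_, ?_, ?_, ?_, ?_, ?_, ?_, ?_, ?_, ?_⟩ <;>
    exact near_of_sBase hf (Or.inr (Or.inl ⟨v, by simp⟩))

/-- The edges at `x_{v,v'}`. -/
theorem near_sx (hf : IsHomC4 (SGraph I) f) (e : ↥(XPairs I)) :
    Near (f (sx I e)) (f (sg I (Sum.inr e.val.1))) ∧
    Near (f (sx I e)) (f (sg I (Sum.inr e.val.2))) ∧
    Near (f (sx I e)) (f (su I e.val.1)) ∧ Near (f (sx I e)) (f (sw I e.val.2)) ∧
    Near (f (sx I e)) (f (sg I (hv I 0))) ∧ Near (f (sx I e)) (f (sg I (hv I 2))) := by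
  refine ⟨?_, ?_, ?_, ?_, ?_, ?_⟩ <;>
    exact near_of_sBase hf (Or.inr (Or.inr (Or.inr ⟨e, by simp⟩)))

/-- Every pair `(v,v')` carrying an `x`-vertex is an edge of the D-graph. -/
theorem near_of_mem_XPairs (hf : IsHomC4 (SGraph I) f) {v v' : Core I}
    (h : (v, v') ∈ XPairs I) :
    Near (f (sg I (Sum.inr v))) (f (sg I (Sum.inr v'))) := by
  simp only [XPairs, Set.mem_ofPred_eq, Prod.mk.injEq] at h
  rcases h with ⟨p, ⟨rfl, rfl⟩ | ⟨rfl, rfl⟩ | ⟨rfl, rfl⟩⟩ |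
    ⟨q, ⟨rfl, rfl⟩ | ⟨rfl, rfl⟩ | ⟨rfl, rfl⟩⟩ | ⟨p, q, h, hq, rfl, rfl⟩ |
    ⟨p, q, h, hp, rfl, rfl⟩ | ⟨p, q, h, hp, hq, rfl, rfl⟩ | ⟨p, q, h, hp, hq, rfl, rfl⟩
  · exact near_of_dBase hf (Or.inr (Or.inl ⟨p, Or.inl ⟨rfl, rfl⟩⟩))
  · exact (near_of_dBase hf (Or.inr (Or.inl ⟨p, Or.inr (Or.inl ⟨rfl, rfl⟩)⟩))).symm
  · exact near_of_dBase hf (Or.inr (Or.inl ⟨p, Or.inr (Or.inr (Or.inl ⟨rfl, rfl⟩))⟩))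
  · exact (near_of_dBase hf (Or.inr (Or.inr (Or.inl ⟨q, Or.inl ⟨rfl, rfl⟩⟩)))).symm
  · exact (near_of_dBase hf (Or.inr (Or.inr (Or.inl ⟨q, Or.inr (Or.inl ⟨rfl, rfl⟩)⟩)))).symm
  · exact (near_of_dBase hf
      (Or.inr (Or.inr (Or.inl ⟨q, Or.inr (Or.inr (Or.inl ⟨rfl, rfl⟩))⟩)))).symm
  · exact (near_of_dBase hf (Or.inr (Or.inr (Or.inr (Or.inr (Or.inl
      ⟨p, q, h, hq, Or.inl ⟨rfl, rfl⟩⟩)))))).symm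
  · exact (near_of_dBase hf (Or.inr (Or.inr (Or.inr (Or.inr (Or.inr (Or.inl
      ⟨p, q, h, hp, Or.inr ⟨rfl, rfl⟩⟩))))))).symm
  · exact near_of_dBase hf (Or.inr (Or.inr (Or.inr (Or.inr (Or.inr (Or.inr (Or.inl
      ⟨p, q, h, hp, hq, Or.inr (Or.inr ⟨rfl, rfl⟩)⟩)))))))
  · exact (near_of_dBase hf (Or.inr (Or.inr (Or.inr (Or.inr (Or.inr (Or.inr (Or.inr (Or.inl
      ⟨p, q, h, hp, hq, Or.inr (Or.inr ⟨rfl, rfl⟩)⟩))))))))).symm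

/-- Every vertex of `G''` is equal or adjacent to `h0` or to `h2`. -/
theorem near_zero_or_two (hf : IsHomC4 (SGraph I) f) (s : SVert I) :
    Near (f s) (f (sg I (hv I 0))) ∨ Near (f s) (f (sg I (hv I 2))) := by
  obtain ⟨h10, h30, h12, h32⟩ := near_hv hf
  rcases s with (i | a | p | p | q | q) | v | v | v | e
  · fin_cases i
    exacts [Or.inl (Near.refl _), Or.inl h10, Or.inr (Near.refl _), Or.inl h30]
  · exact Or.inl (near_ev hf a)
  · exact Or.inl (near_av hf p)
  · exact Or.inr (near_bv hf p)
  · exact Or.inr (near_cv hf q)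
  · exact Or.inl (near_dv hf q)
  · exact Or.inl (near_gadget hf v).1
  · exact Or.inr (near_gadget hf v).2.2.2.2.1
  · exact Or.inl (near_gadget hf v).2.2.1
  · exact Or.inl (near_sx hf e).2.2.2.2.1

/-- The values `x`, `y` are both near the image of `h0`, or both near the image of `h2`, or have
a common neighbour near the images of both `h0` and `h2`. -/
def Linked (f : SVert I → ZMod 4) (x y : ZMod 4) : Prop :=
  (Near x (f (sg I (hv I 0))) ∧ Near y (f (sg I (hv I 0)))) ∨
  (Near x (f (sg I (hv I 2))) ∧ Near y (f (sg I (hv I 2)))) ∨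
  ∃ z, Near z x ∧ Near z y ∧ Near z (f (sg I (hv I 0))) ∧ Near z (f (sg I (hv I 2)))

theorem Linked.symm {x y : ZMod 4} (h : Linked f x y) : Linked f y x := by
  rcases h with h | h | ⟨z, h1, h2, h3⟩
  exacts [Or.inl h.symm, Or.inr (Or.inl h.symm), Or.inr (Or.inr ⟨z, h2, h1, h3⟩)]

theorem linked_of_mem_XPairs (hf : IsHomC4 (SGraph I) f) {v v' : Core I}
    (h : (v, v') ∈ XPairs I) :
    Linked f (f (sg I (Sum.inr v))) (f (sg I (Sum.inr v'))) := by
  obtain ⟨h1, h2, -, -, h3, h4⟩ := near_sx hf ⟨_, h⟩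
  exact Or.inr (Or.inr ⟨_, h1, h2, h3, h4⟩)

theorem linked_of_dBase (hf : IsHomC4 (SGraph I) f) {u v : DVert I} (h : dBase I u v) :
    Linked f (f (sg I u)) (f (sg I v)) := by
  obtain ⟨h10, h30, h12, h32⟩ := near_hv hf
  have huv := near_of_dBase hf h
  have zero {s t : SVert I} (hs : Near (f s) (f (sg I (hv I 0))))
    (ht : Near (f t) (f (sg I (hv I 0)))) : Linked f (f s) (f t) := Or.inl ⟨hs, ht⟩
  have two {s t : SVert I} (hs : Near (f s) (f (sg I (hv I 2))))
    (ht : Near (f t) (f (sg I (hv I 2)))) : Linked f (f s) (f t) := Or.inr (Or.inl ⟨hs, ht⟩)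
  rcases h with ⟨i, rfl, rfl⟩ |
    ⟨p, ⟨rfl, rfl⟩ | ⟨rfl, rfl⟩ | ⟨rfl, rfl⟩ | ⟨rfl, rfl⟩ | ⟨rfl, rfl⟩ | ⟨rfl, rfl⟩ | ⟨rfl, rfl⟩⟩ |
    ⟨q, ⟨rfl, rfl⟩ | ⟨rfl, rfl⟩ | ⟨rfl, rfl⟩ | ⟨rfl, rfl⟩ | ⟨rfl, rfl⟩ | ⟨rfl, rfl⟩ | ⟨rfl, rfl⟩⟩ |
    ⟨a, rfl, rfl⟩ | ⟨p, q, h, hq, ⟨rfl, rfl⟩ | ⟨rfl, rfl⟩⟩ |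
    ⟨p, q, h, hp, ⟨rfl, rfl⟩ | ⟨rfl, rfl⟩⟩ |
    ⟨p, q, h, hp, hq, ⟨rfl, rfl⟩ | ⟨rfl, rfl⟩ | ⟨rfl, rfl⟩⟩ |
    ⟨p, q, h, hp, hq, ⟨rfl, rfl⟩ | ⟨rfl, rfl⟩ | ⟨rfl, rfl⟩⟩ |
    ⟨p, p', -, ⟨rfl, rfl⟩ | ⟨rfl, rfl⟩⟩ | ⟨q, q', -, ⟨rfl, rfl⟩ | ⟨rfl, rfl⟩⟩
  · fin_cases i
    exacts [zero (Near.refl _) h10, two h12 (Near.refl _), two (Near.refl _) h32,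
      zero h30 (Near.refl _)]
  · exact zero (near_av hf p) (near_ev hf p)
  · exact (linked_of_mem_XPairs hf (Or.inl ⟨p, Or.inr (Or.inl rfl)⟩)).symm
  · exact linked_of_mem_XPairs hf (Or.inl ⟨p, Or.inr (Or.inr rfl)⟩)
  · exact zero huv (Near.refl _)
  · exact zero (near_av hf p) h30
  · exact two (near_bv hf p) h12
  · exact two huv (Near.refl _)
  · exact (linked_of_mem_XPairs hf (Or.inr (Or.inl ⟨q, Or.inl rfl⟩))).symm
  · exact zero (near_dv hf q) (near_ev hf q)
  · exact (linked_of_mem_XPairs hf (Or.inr (Or.inl ⟨q, Or.inr (Or.inr rfl)⟩))).symm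
  · exact two huv (Near.refl _)
  · exact two (near_cv hf q) h32
  · exact zero huv (Near.refl _)
  · exact zero (near_dv hf q) h10
  · exact zero (Near.refl _) (near_ev hf a)
  · exact (linked_of_mem_XPairs hf (Or.inr (Or.inr (Or.inl ⟨p, q, h, hq, rfl⟩)))).symm
  · exact two huv (Near.refl _)
  · exact two huv (Near.refl _)
  · exact (linked_of_mem_XPairs hf
      (Or.inr (Or.inr (Or.inr (Or.inl ⟨p, q, h, hp, rfl⟩))))).symm
  · exact two huv (Near.refl _)
  · exact two huv (Near.refl _)
  · exact linked_of_mem_XPairs hf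
      (Or.inr (Or.inr (Or.inr (Or.inr (Or.inl ⟨p, q, h, hp, hq, rfl⟩)))))
  · exact two huv (Near.refl _)
  · exact two huv (Near.refl _)
  · exact (linked_of_mem_XPairs hf
      (Or.inr (Or.inr (Or.inr (Or.inr (Or.inr ⟨p, q, h, hp, hq, rfl⟩)))))).symm
  · exact zero (near_av hf p) (near_av hf p')
  · exact two (near_bv hf p) (near_bv hf p')
  · exact two (near_cv hf q) (near_cv hf q')
  · exact zero (near_dv hf q) (near_dv hf q')

theorem linked_or_of_sBase (hf : IsHomC4 (SGraph I) f) {s t : SVert I} (h : sBase I s t) :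
    Linked f (f s) (f t) ∨
      ∃ v : Core I, (s = sg I (Sum.inr v) ∧ t = sw I v) ∨ (s = su I v ∧ t = sg I (Sum.inr v)) := by
  obtain ⟨h10, h30, h12, h32⟩ := near_hv hf
  have zero {s t : SVert I} (hs : Near (f s) (f (sg I (hv I 0))))
    (ht : Near (f t) (f (sg I (hv I 0)))) : Linked f (f s) (f t) := Or.inl ⟨hs, ht⟩
  have two {s t : SVert I} (hs : Near (f s) (f (sg I (hv I 2))))
    (ht : Near (f t) (f (sg I (hv I 2)))) : Linked f (f s) (f t) := Or.inr (Or.inl ⟨hs, ht⟩)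
  have toX (e : ↥(XPairs I)) (t : SVert I) : Linked f (f (sx I e)) (f t) := by
    obtain ⟨-, -, -, -, h0, h2⟩ := near_sx hf e
    exact (near_zero_or_two hf t).elim (zero h0) (two h2)
  rcases h with ⟨u, v, h, rfl, rfl⟩ | ⟨v, h⟩ | ⟨v, v', -, ⟨rfl, rfl⟩ | ⟨rfl, rfl⟩⟩ | ⟨e, h⟩
  · exact Or.inl (linked_of_dBase hf h)
  · obtain ⟨u0, -, y0, y2, w2, -, -, -, uy, -, wy⟩ := near_gadget hf v
    rcases h with ⟨rfl, rfl⟩ | ⟨rfl, rfl⟩ | ⟨rfl, rfl⟩ | ⟨rfl, rfl⟩ | ⟨rfl, rfl⟩ | ⟨rfl, rfl⟩ |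
      ⟨rfl, rfl⟩ | ⟨rfl, rfl⟩ | ⟨rfl, rfl⟩ | ⟨rfl, rfl⟩ | ⟨rfl, rfl⟩
    · exact Or.inl (zero u0 (Near.refl _))
    · exact Or.inl (zero u0 h10)
    · exact Or.inl (zero y0 (Near.refl _))
    · exact Or.inl (two y2 (Near.refl _))
    · exact Or.inl (two w2 (Near.refl _))
    · exact Or.inl (two w2 h32)
    · exact Or.inr ⟨v, Or.inr ⟨rfl, rfl⟩⟩
    · exact Or.inl (Or.inr (Or.inr ⟨_, uy.symm, wy.symm, y0, y2⟩))
    · exact Or.inl (zero u0 y0)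
    · exact Or.inr ⟨v, Or.inl ⟨rfl, rfl⟩⟩
    · exact Or.inl (two w2 y2)
  · exact Or.inl (zero (near_gadget hf v).1 (near_gadget hf v').1)
  · exact Or.inl (two (near_gadget hf v).2.2.2.2.1 (near_gadget hf v').2.2.2.2.1)
  · left
    rcases h with ⟨rfl, rfl⟩ | ⟨rfl, rfl⟩ | ⟨rfl, rfl⟩ | ⟨rfl, rfl⟩ | ⟨rfl, rfl⟩ | ⟨rfl, rfl⟩ <;>
      exact toX e _

theorem apply_hv_two_ne_zero (hf : IsCompactionC4 (SGraph I) f) (h0 : f (sg I (hv I 0)) = 0) :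
    f (sg I (hv I 2)) ≠ 0 := by
  intro h2
  obtain ⟨s, t, -, hs, -⟩ := hf.2 2 3 (by decide)
  have h := near_zero_or_two hf.1 s
  rw [h0, h2, hs] at h
  revert h; decide

theorem apply_hv_two_ne_one (hf : IsCompactionC4 (SGraph I) f) (h0 : f (sg I (hv I 0)) = 0) :
    f (sg I (hv I 2)) ≠ 1 := by
  intro h2
  have not_linked : ¬ Linked f 3 2 := by
    unfold Linked; rw [h0, h2]; decide
  have key : ∀ u w y v : ZMod 4, Near u 0 → Near y 0 → Near y 1 → Near w 1 → Near u v →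
      Near u w → Near u y → Near v w → Near w y →
      ¬ (v = 3 ∧ w = 2) ∧ ¬ (v = 2 ∧ w = 3) ∧ ¬ (u = 3 ∧ v = 2) ∧ ¬ (u = 2 ∧ v = 3) := by
    decide
  have gadget (v : Core I) := by
    have h := near_gadget hf.1 v
    rw [h0, h2] at h
    obtain ⟨u0, -, y0, y2, w2, -, uv, uw, uy, vw, wy⟩ := h
    exact key _ _ _ _ u0 y0 y2 w2 uv uw uy vw wy
  obtain ⟨s, t, hst, hs, ht⟩ := hf.2 3 2 (by decide)
  rcases ((SimpleGraph.fromRel_adj _ _ _).1 hst).2 with h | h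
  · rcases linked_or_of_sBase hf.1 h with h | ⟨v, ⟨rfl, rfl⟩ | ⟨rfl, rfl⟩⟩
    · rw [hs, ht] at h; exact not_linked h
    · exact (gadget v).1 ⟨hs, ht⟩
    · exact (gadget v).2.2.1 ⟨hs, ht⟩
  · rcases linked_or_of_sBase hf.1 h with h | ⟨v, ⟨rfl, rfl⟩ | ⟨rfl, rfl⟩⟩
    · rw [hs, ht] at h; exact not_linked h.symm
    · exact (gadget v).2.1 ⟨ht, hs⟩
    · exact (gadget v).2.2.2 ⟨ht, hs⟩

theorem not_apply_hv_eq_one (hf : IsCompactionC4 (SGraph I) f) (h0 : f (sg I (hv I 0)) = 0)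
    (h2 : f (sg I (hv I 2)) = 2) : ¬ (f (sg I (hv I 1)) = 1 ∧ f (sg I (hv I 3)) = 1) := by
  rintro ⟨h1, h3⟩
  have key : ∀ u w v : ZMod 4, Near u 0 → Near u 1 → Near w 2 → Near w 1 → Near u w →
      Near u v → Near v w → v ≠ 3 ∧ u ≠ 3 ∧ w ≠ 3 := by
    decide
  have gadget (v : Core I) := by
    have h := near_gadget hf.1 v
    rw [h0, h1, h2, h3] at h
    exact h
  have core (v : Core I) : f (sg I (Sum.inr v)) ≠ 3 ∧ f (su I v) ≠ 3 ∧ f (sw I v) ≠ 3 := by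
    obtain ⟨u0, u1, -, -, w2, w3, uv, uw, -, vw, -⟩ := gadget v
    exact key _ _ _ u0 u1 w2 w3 uw uv vw
  have keyx : ∀ v u w' : ZMod 4, Near u 0 → Near u 1 → Near u v → Near w' 2 → Near w' 1 →
      v ≠ 3 → Near 3 v → Near 3 u → Near 3 w' → u = 0 ∧ w' = 2 ∧ v = 0 := by
    decide
  have keyv' : ∀ v' : ZMod 4, Near v' 2 → v' ≠ 3 → Near 0 v' → ¬ Near 3 v' := by decide
  obtain ⟨s, t, -, hs, -⟩ := hf.2 3 2 (by decide)
  rcases s with (i | v) | v | v | v | e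
  · have : ∀ i, f (sg I (hv I i)) ≠ 3 := by
      intro i
      fin_cases i
      exacts [h0 ▸ by decide, h1 ▸ by decide, h2 ▸ by decide, h3 ▸ by decide]
    exact this i hs
  · exact (core v).1 hs
  · exact (core v).2.1 hs
  · exact (core v).2.2 hs
  · obtain ⟨u0, u1, -, -, w2, w3, -, uw, uy, -, wy⟩ := gadget v
    exact (key _ _ _ u0 u1 w2 w3 uw uy wy.symm).1 hs
  · obtain ⟨⟨v, v'⟩, he⟩ := e
    change f (sx I ⟨(v, v'), he⟩) = 3 at hs
    obtain ⟨xv, xv', xu, xw, -⟩ := near_sx hf.1 ⟨(v, v'), he⟩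
    rw [hs] at xv xv' xu xw
    obtain ⟨u0, u1, -, -, -, -, uv, -⟩ := gadget v
    obtain ⟨-, -, -, -, w2, w3, -, -, -, vw', -⟩ := gadget v'
    have hvv' := near_of_mem_XPairs hf.1 he
    obtain ⟨-, hw', hv⟩ := keyx _ _ _ u0 u1 uv w2 w3 (core v).1 xv xu xw
    rw [hw'] at vw'
    rw [hv] at hvv'
    exact keyv' _ vw' (core v').1 hvv' xv'

theorem IsCompactionC4.comp_equiv {V : Type} {G : SimpleGraph V} {f : V → ZMod 4}
    (hf : IsCompactionC4 G f) (σ : Equiv.Perm (ZMod 4))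
    (hσ : ∀ x y, C4adj (σ x) (σ y) ↔ C4adj x y) : IsCompactionC4 G (σ ∘ f) := by
  refine ⟨fun u v h => (hf.1 u v h).imp (congrArg σ) (hσ _ _).2, fun x y h => ?_⟩
  obtain ⟨u, v, huv, hu, hv⟩ := hf.2 (σ.symm x) (σ.symm y) ((hσ _ _).1 (by simpa using h))
  exact ⟨u, v, huv, by simp [hu], by simp [hv]⟩

theorem IsCompactionC4.neg {V : Type} {G : SimpleGraph V} {f : V → ZMod 4}
    (hf : IsCompactionC4 G f) : IsCompactionC4 G (fun s => -f s) :=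
  hf.comp_equiv (Equiv.neg _) (by unfold C4adj; decide)

theorem IsCompactionC4.sub_const {V : Type} {G : SimpleGraph V} {f : V → ZMod 4}
    (hf : IsCompactionC4 G f) (c : ZMod 4) : IsCompactionC4 G (fun s => f s - c) :=
  hf.comp_equiv (Equiv.subRight c) (by
    simp only [Equiv.subRight_apply]; unfold C4adj; revert c; decide)

theorem exists_sRetr_of_apply_hv_zero (hf : IsCompactionC4 (SGraph I) f)
    (h0 : f (sg I (hv I 0)) = 0) : ∃ g : SVert I → ZMod 4, SRetr I g := by
  have n0 : -f (sg I (hv I 0)) = 0 := by rw [h0]; rfl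
  have h2 : f (sg I (hv I 2)) = 2 := by
    have a := apply_hv_two_ne_zero hf h0
    have b := apply_hv_two_ne_one hf h0
    have c := apply_hv_two_ne_one hf.neg n0
    generalize f (sg I (hv I 2)) = x at a b c
    revert x; decide
  have a := not_apply_hv_eq_one hf h0 h2
  have b := not_apply_hv_eq_one hf.neg n0 (by rw [h2]; rfl)
  obtain ⟨h10, h30, h12, h32⟩ := near_hv hf.1
  rw [h0] at h10 h30
  rw [h2] at h12 h32
  have key : ∀ x y : ZMod 4, Near x 0 → Near y 0 → Near x 2 → Near y 2 → ¬ (x = 1 ∧ y = 1) →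
      ¬ (-x = 1 ∧ -y = 1) → (x = 1 ∧ y = 3) ∨ (x = 3 ∧ y = 1) := by
    decide
  rcases key _ _ h10 h30 h12 h32 a b with ⟨h1, h3⟩ | ⟨h1, h3⟩
  · refine ⟨f, hf.1, fun i => ?_⟩
    fin_cases i
    exacts [h0, h1, h2, h3]
  · refine ⟨_, hf.neg.1, fun i => ?_⟩
    fin_cases i
    exacts [n0, congrArg Neg.neg h1, congrArg Neg.neg h2, congrArg Neg.neg h3]

end

/-- If the semi-compactor admits a compaction to the reflexive 4-cycle `H`,
then it retracts to `H`. -/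
theorem stmt11 (α : Type) [Fintype α] (I : Inst α)
    (f : SVert I → ZMod 4) (hf : IsCompactionC4 (SGraph I) f) :
    ∃ g : SVert I → ZMod 4, SRetr I g :=
  exists_sRetr_of_apply_hv_zero (hf.sub_const (f (sg I (hv I 0)))) (sub_self _)

end Paper
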